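/- (Restriction Lemma) Fix a threshold-weighted graph (G,θ), a positive integer n, a join-tree A over G, and a set S ⊆ V(G). For every relation 𝒜 ⊆ [n]^{A|S}, every T ⊇ S, and every z ∈ [n]^T, χ_{A|T}(𝒜↾z) ≤ χ_{A|S}(𝒜). -/

import Mathlib

open scoped Classical

noncomputable section

namespace Paper

/-- A join-tree: a finite rooted binary tree whose leaves are labeled by
edges (elements of `Sym2 α`) or by `⊥` (here `none`). -/
inductive JoinTree (α : Type*) where
  | leaf : Option (Sym2 α) → JoinTree α
  | node : JoinTree α → JoinTree α → JoinTree α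

variable {V : Type*}

/-- The vertex set of a finite edge set (a finite subgraph given by its edges). -/
def vset (F : Finset (Sym2 V)) : Set V := {v | ∃ e ∈ F, v ∈ e}

lemma vset_mono {F F' : Finset (Sym2 V)} (h : F ⊆ F') : vset F ⊆ vset F' := by
  rintro v ⟨e, he, hv⟩
  exact ⟨e, h he, hv⟩

/-- `Δ_θ(F) = |V(F)| − Σ_{e ∈ E(F)} θ(e)`. -/
def Delta (θ : Sym2 V → ℝ) (F : Finset (Sym2 V)) : ℝ :=
  ((vset F).ncard : ℝ) - ∑ e ∈ F, θ e

/-- `θ` is a threshold weighting on the graph with edge set `E`: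
it takes values in `[0,2]` on `E`, `Δ_θ(F) ≥ 0` for every finite subgraph `F ⊆ E`,
and `Δ_θ(E) = 0` whenever `E` is finite. -/
def IsThresholdWeighting (E : Set (Sym2 V)) (θ : Sym2 V → ℝ) : Prop :=
  (∀ e ∈ E, 0 ≤ θ e ∧ θ e ≤ 2) ∧
  (∀ F : Finset (Sym2 V), (F : Set (Sym2 V)) ⊆ E → 0 ≤ Delta θ F) ∧
  (∀ hE : E.Finite, Delta θ hE.toFinset = 0)

/-- `F ⊖ S`: the union of the connected components of `F` that are vertex-disjoint
from `S`. -/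
def elimS (F : Finset (Sym2 V)) (S : Set V) : Finset (Sym2 V) :=
  F.filter fun e =>
    ∀ v ∈ e, ∀ s ∈ S, ¬ (SimpleGraph.fromEdgeSet (F : Set (Sym2 V))).Reachable v s

/-- The graph with edge set `F` is connected. -/
def ConnE (F : Finset (Sym2 V)) : Prop :=
  ∀ u ∈ vset F, ∀ w ∈ vset F, (SimpleGraph.fromEdgeSet (F : Set (Sym2 V))).Reachable u w

/-- The subgraph of `F` induced on a vertex set `T`. -/
def induced (F : Finset (Sym2 V)) (T : Set V) : Finset (Sym2 V) :=
  F.filter fun e => ∀ v ∈ e, v ∈ T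

namespace JoinTree

/-- The graph of a join-tree: the finite subgraph whose edges are the labels
occurring in the tree. -/
def graph : JoinTree V → Finset (Sym2 V)
  | leaf none => ∅
  | leaf (some e) => {e}
  | node B C => graph B ∪ graph C

/-- `Sub D A` means `D ⪯ A`: `D = ⟨⟩`, or `D = A`, or `D` is a sub-join-tree of a
child of `A`. -/
inductive Sub : JoinTree V → JoinTree V → Prop
  | empty (A : JoinTree V) : Sub (leaf none) A
  | refl (A : JoinTree V) : Sub A A
  | left {D B C : JoinTree V} : Sub D B → Sub D (node B C)
  | right {D B C : JoinTree V} : Sub D C → Sub D (node B C)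

/-- `SubP D A` means `D ≺ A`, i.e. `D ⪯ A` and `D ≠ A`. -/
def SubP (D A : JoinTree V) : Prop := Sub D A ∧ D ≠ A

/-- A join-tree is atomic if it is a single (labeled or unlabeled) leaf. -/
def Atomic (A : JoinTree V) : Prop := ∃ l, A = leaf l

/-- Replace every leaf label not belonging to `E'` by `⊥`. -/
def prune : JoinTree V → Finset (Sym2 V) → JoinTree V
  | leaf none, _ => leaf none
  | leaf (some e), E' => if e ∈ E' then leaf (some e) else leaf none
  | node B C, E' => node (prune B E') (prune C E')

/-- `A ⊖ S`: delete all leaf labels except those belonging to `Gr(A) ⊖ S`. -/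
def elimT (A : JoinTree V) (S : Set V) : JoinTree V := prune A (Paper.elimS A.graph S)

/-- `A` is a join-tree over the graph with edge set `E` (all labels come from `E`). -/
def Over (E : Set (Sym2 V)) (A : JoinTree V) : Prop := (A.graph : Set (Sym2 V)) ⊆ E

lemma graph_mono_of_sub {D A : JoinTree V} (h : Sub D A) : D.graph ⊆ A.graph := by
  induction h with
  | empty A => intro e he; simp [graph] at he
  | refl A => exact Finset.Subset.refl _
  | left _ ih => exact ih.trans Finset.subset_union_left
  | right _ ih => exact ih.trans Finset.subset_union_right

end JoinTree

open JoinTree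

/-- The coordinate set of the relation space `[n]^{F|S}`, namely `V(F) ∖ S`. -/
def coords (F : Finset (Sym2 V)) (S : Set V) : Set V := vset F \ S

lemma coords_mono {F F' : Finset (Sym2 V)} (h : F ⊆ F') (S : Set V) :
    coords F S ⊆ coords F' S := fun v hv => ⟨vset_mono h hv.1, hv.2⟩

lemma coords_anti (F : Finset (Sym2 V)) {S T : Set V} (hST : S ⊆ T) :
    coords F T ⊆ coords F S := fun v hv => ⟨hv.1, fun h => hv.2 (hST h)⟩

/-- Tuples `[n]^U`. -/
def Tup (n : ℕ) (U : Set V) : Type _ := U → Fin n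

/-- The density `μ(𝒜) = |𝒜| / n^{|U|}` of a relation `𝒜 ⊆ [n]^U`. -/
def mu (n : ℕ) {U : Set V} (R : Set (Tup n U)) : ℝ :=
  (R.ncard : ℝ) / (n : ℝ) ^ U.ncard

/-- Projection of a tuple to a subset of the coordinates. -/
def projMap (n : ℕ) {U U' : Set V} (h : U' ⊆ U) (x : Tup n U) : Tup n U' :=
  fun v => x ⟨v.1, h v.2⟩

/-- Projection of a relation to a subset of the coordinates. -/
def projSet (n : ℕ) {U U' : Set V} (h : U' ⊆ U) (R : Set (Tup n U)) : Set (Tup n U') :=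
  projMap n h '' R

/-- The restriction `𝒜 ↾ z ⊆ [n]^{V(F) ∖ T}` of a relation `𝒜 ⊆ [n]^{F|S}`,
for `T ⊇ S` and an assignment `z`: those `x` such that some `y ∈ 𝒜` agrees with
`x` on `V(F) ∖ T` and agrees with `z` on `V(F) ∩ T`. -/
def restrictRel (n : ℕ) (F : Finset (Sym2 V)) {S T : Set V} (hST : S ⊆ T)
    (z : V → Fin n) (R : Set (Tup n (coords F S))) : Set (Tup n (coords F T)) :=
  { x | ∃ y ∈ R, (∀ v : coords F T, y ⟨v.1, coords_anti F hST v.2⟩ = x v) ∧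
        (∀ v : coords F S, v.1 ∈ T → y v = z v.1) }

/-- `𝒜` is an `F|S`-pathset: every restriction has density at most
`(1/n)^{Δ_θ(F ⊖ T)}`. -/
def IsPathset (n : ℕ) (θ : Sym2 V → ℝ) (F : Finset (Sym2 V)) (S : Set V)
    (R : Set (Tup n (coords F S))) : Prop :=
  ∀ (T : Set V) (hST : S ⊆ T) (z : V → Fin n),
    mu n (restrictRel n F hST z R) ≤ ((1 : ℝ) / n) ^ (Delta θ (elimS F T))

/-- Pathset complexity `χ_{A|S}(𝒜)`. -/
def pchi (n : ℕ) (θ : Sym2 V → ℝ) (S : Set V) :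
    (A : JoinTree V) → Set (Tup n (coords A.graph S)) → ℕ
  | JoinTree.leaf l, R =>
      sInf { m | ∃ f : Fin m → Set (Tup n (coords (JoinTree.leaf l : JoinTree V).graph S)),
        (∀ i, IsPathset n θ (JoinTree.leaf l : JoinTree V).graph S (f i)) ∧ R ⊆ ⋃ i, f i }
  | JoinTree.node B C, R =>
      sInf { t | ∃ (m : ℕ)
        (As : Fin m → Set (Tup n (coords (JoinTree.node B C).graph S)))
        (Bs : Fin m → Set (Tup n (coords B.graph S)))
        (Cs : Fin m → Set (Tup n (coords C.graph S))),
        (∀ i, IsPathset n θ (JoinTree.node B C).graph S (As i)) ∧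
        (∀ i, IsPathset n θ B.graph S (Bs i)) ∧
        (∀ i, IsPathset n θ C.graph S (Cs i)) ∧
        (∀ i, ∀ x ∈ As i,
          projMap n (coords_mono
            (JoinTree.graph_mono_of_sub (JoinTree.Sub.left (JoinTree.Sub.refl B))) S) x ∈ Bs i ∧
          projMap n (coords_mono
            (JoinTree.graph_mono_of_sub (JoinTree.Sub.right (JoinTree.Sub.refl C))) S) x ∈ Cs i) ∧
        (R ⊆ ⋃ i, As i) ∧
        t = ∑ i, max (pchi n θ S B (Bs i)) (pchi n θ S C (Cs i)) }

lemma finite_vset (F : Finset (Sym2 V)) : (vset F).Finite := by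
  have h : vset F = ⋃ e ∈ F, {v | v ∈ e} := by
    ext v
    simp [vset]
  rw [h]
  refine F.finite_toSet.biUnion fun e _ => ?_
  induction e using Sym2.ind with
  | _ a b => exact (Set.toFinite {a, b}).subset fun v hv => by simpa using hv

lemma finite_coords (F : Finset (Sym2 V)) (S : Set V) : (coords F S).Finite :=
  (finite_vset F).subset Set.sdiff_subset

instance finite_tup (n : ℕ) (F : Finset (Sym2 V)) (S : Set V) :
    Finite (Tup n (coords F S)) := by
  have := (finite_coords F S).to_subtype
  unfold Tup
  infer_instance

lemma restrictRel_mono (n : ℕ) (F : Finset (Sym2 V)) {S T : Set V} (hST : S ⊆ T)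
    (z : V → Fin n) {R R' : Set (Tup n (coords F S))} (h : R ⊆ R') :
    restrictRel n F hST z R ⊆ restrictRel n F hST z R' := by
  rintro x ⟨y, hy, hxy⟩
  exact ⟨y, h hy, hxy⟩

lemma restrictRel_iUnion (n : ℕ) (F : Finset (Sym2 V)) {S T : Set V} (hST : S ⊆ T)
    (z : V → Fin n) {ι : Type*} (R : ι → Set (Tup n (coords F S))) :
    restrictRel n F hST z (⋃ i, R i) = ⋃ i, restrictRel n F hST z (R i) := by
  ext x
  simp only [restrictRel, Set.mem_iUnion, Set.mem_ofPred_eq]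
  constructor
  · rintro ⟨y, ⟨i, hi⟩, h⟩
    exact ⟨i, y, hi, h⟩
  · rintro ⟨i, y, hi, h⟩
    exact ⟨y, ⟨i, hi⟩, h⟩

lemma restrictRel_subsingleton (n : ℕ) (F : Finset (Sym2 V)) {S T : Set V} (hST : S ⊆ T)
    (z : V → Fin n) {R : Set (Tup n (coords F S))} (hR : R.Subsingleton) :
    (restrictRel n F hST z R).Subsingleton := by
  rintro x ⟨y, hy, hxy, -⟩ x' ⟨y', hy', hxy', -⟩
  obtain rfl := hR hy hy'
  funext v
  rw [← hxy, ← hxy']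

lemma mu_mono (n : ℕ) (F : Finset (Sym2 V)) (S : Set V)
    {R R' : Set (Tup n (coords F S))} (h : R ⊆ R') : mu n R ≤ mu n R' := by
  unfold mu
  gcongr
  exact Set.toFinite _

/-- Restricting twice is contained in a single restriction along the combined assignment. -/
lemma restrictRel_restrictRel_subset (n : ℕ) (F : Finset (Sym2 V)) {S T U : Set V}
    (hST : S ⊆ T) (hTU : T ⊆ U) (z w : V → Fin n) (R : Set (Tup n (coords F S))) :
    restrictRel n F hTU w (restrictRel n F hST z R) ⊆
      restrictRel n F (hST.trans hTU) (fun v => if v ∈ T then z v else w v) R := by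
  rintro x ⟨y, ⟨y', hy', hyT, hyz⟩, hxU, hxw⟩
  refine ⟨y', hy', fun v => ?_, fun v hv => ?_⟩
  · rw [← hxU v, ← hyT]
  · by_cases hT : v.1 ∈ T
    · simpa [hT] using hyz v hT
    · simpa [hT] using (hyT ⟨v.1, v.2.1, hT⟩).trans (hxw ⟨v.1, v.2.1, hT⟩ hv)

lemma IsPathset.restrictRel {n : ℕ} {θ : Sym2 V → ℝ} {F : Finset (Sym2 V)} {S T : Set V}
    {R : Set (Tup n (coords F S))} (h : IsPathset n θ F S R) (hST : S ⊆ T) (z : V → Fin n) :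
    IsPathset n θ F T (restrictRel n F hST z R) := fun U hTU w =>
  (mu_mono n F U (restrictRel_restrictRel_subset n F hST hTU z w R)).trans
    (h U (hST.trans hTU) _)

lemma vset_elimS_subset (F : Finset (Sym2 V)) (T : Set V) : vset (elimS F T) ⊆ coords F T := by
  rintro v ⟨e, he, hv⟩
  obtain ⟨heF, h⟩ := Finset.mem_filter.1 he
  exact ⟨⟨e, heF, hv⟩, fun hT => h v hv v hT (SimpleGraph.Reachable.refl v)⟩

lemma Delta_elimS_le {θ : Sym2 V → ℝ} {F : Finset (Sym2 V)} (hθ : ∀ e ∈ F, 0 ≤ θ e)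
    (T : Set V) : Delta θ (elimS F T) ≤ (coords F T).ncard := by
  have h1 : ((vset (elimS F T)).ncard : ℝ) ≤ (coords F T).ncard := by
    exact_mod_cast Set.ncard_le_ncard (vset_elimS_subset F T) (finite_coords F T)
  have h2 : 0 ≤ ∑ e ∈ elimS F T, θ e :=
    Finset.sum_nonneg fun e he => hθ e (Finset.mem_filter.1 he).1
  unfold Delta
  linarith

lemma isPathset_of_subsingleton {n : ℕ} (hn : 0 < n) {θ : Sym2 V → ℝ}
    {F : Finset (Sym2 V)} (hθ : ∀ e ∈ F, 0 ≤ θ e) {S : Set V}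
    {R : Set (Tup n (coords F S))} (hR : R.Subsingleton) : IsPathset n θ F S R := by
  intro T hST z
  have hn' : (0 : ℝ) < n := by exact_mod_cast hn
  have h1 : ((restrictRel n F hST z R).ncard : ℝ) ≤ 1 := by
    exact_mod_cast Set.ncard_le_one_iff_subsingleton.2 (restrictRel_subsingleton n F hST z hR)
  calc mu n (restrictRel n F hST z R)
      ≤ 1 / (n : ℝ) ^ (coords F T).ncard := by
        unfold mu
        gcongr
    _ = ((1 : ℝ) / n) ^ ((coords F T).ncard : ℝ) := by
        rw [Real.rpow_natCast, one_div_pow]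
    _ ≤ ((1 : ℝ) / n) ^ (Delta θ (elimS F T)) := by
        refine Real.rpow_le_rpow_of_exponent_ge (by positivity) ?_ (Delta_elimS_le hθ T)
        rw [div_le_one hn']
        exact_mod_cast hn

/-- Every relation is covered by finitely many singletons. -/
lemma exists_singleton_cover (n : ℕ) (F : Finset (Sym2 V)) (S : Set V) :
    ∃ (m : ℕ) (x : Fin m → Tup n (coords F S)), ⋃ i, {x i} = Set.univ := by
  obtain ⟨m, ⟨e⟩⟩ := Finite.exists_equiv_fin (Tup n (coords F S))
  exact ⟨m, e.symm, Set.eq_univ_of_forall fun x => Set.mem_iUnion.2 ⟨e x, by simp⟩⟩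

/-- An optimal cover of a relation at a leaf. -/
lemma exists_leaf_cover {n : ℕ} (hn : 0 < n) {θ : Sym2 V → ℝ} (S : Set V)
    (l : Option (Sym2 V)) (hθ : ∀ e ∈ (leaf l).graph, 0 ≤ θ e)
    (R : Set (Tup n (coords (leaf l).graph S))) :
    ∃ f : Fin (pchi n θ S (leaf l) R) → Set (Tup n (coords (leaf l).graph S)),
      (∀ i, IsPathset n θ (leaf l).graph S (f i)) ∧ R ⊆ ⋃ i, f i := by
  rw [pchi]
  refine Nat.sInf_mem (s := {m | ∃ f : Fin m → Set (Tup n (coords (leaf l).graph S)),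
      (∀ i, IsPathset n θ (leaf l).graph S (f i)) ∧ R ⊆ ⋃ i, f i}) ?_
  obtain ⟨m, x, hx⟩ := exists_singleton_cover n (leaf l).graph S
  exact ⟨m, fun i => {x i},
    fun i => isPathset_of_subsingleton hn hθ Set.subsingleton_singleton,
    by rw [hx]; exact Set.subset_univ R⟩

/-- `t` is the cost of some decomposition of `R` into joins of pathsets. -/
def IsNodeCost (n : ℕ) (θ : Sym2 V → ℝ) (S : Set V) (B C : JoinTree V)
    (R : Set (Tup n (coords (node B C).graph S))) (t : ℕ) : Prop :=
  ∃ (m : ℕ)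
    (As : Fin m → Set (Tup n (coords (node B C).graph S)))
    (Bs : Fin m → Set (Tup n (coords B.graph S)))
    (Cs : Fin m → Set (Tup n (coords C.graph S))),
    (∀ i, IsPathset n θ (node B C).graph S (As i)) ∧
    (∀ i, IsPathset n θ B.graph S (Bs i)) ∧
    (∀ i, IsPathset n θ C.graph S (Cs i)) ∧
    (∀ i, ∀ x ∈ As i,
      projMap n (coords_mono (graph_mono_of_sub (Sub.left (Sub.refl B))) S) x ∈ Bs i ∧
      projMap n (coords_mono (graph_mono_of_sub (Sub.right (Sub.refl C))) S) x ∈ Cs i) ∧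
    (R ⊆ ⋃ i, As i) ∧
    t = ∑ i, max (pchi n θ S B (Bs i)) (pchi n θ S C (Cs i))

lemma pchi_node (n : ℕ) (θ : Sym2 V → ℝ) (S : Set V) (B C : JoinTree V)
    (R : Set (Tup n (coords (node B C).graph S))) :
    pchi n θ S (node B C) R = sInf {t | IsNodeCost n θ S B C R t} := by
  rw [pchi]
  rfl

/-- The complexity at an inner node is attained by some decomposition. -/
lemma isNodeCost_pchi {n : ℕ} (hn : 0 < n) {θ : Sym2 V → ℝ} (S : Set V)
    (B C : JoinTree V) (hθ : ∀ e ∈ (node B C).graph, 0 ≤ θ e)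
    (R : Set (Tup n (coords (node B C).graph S))) :
    IsNodeCost n θ S B C R (pchi n θ S (node B C) R) := by
  rw [pchi_node]
  refine Nat.sInf_mem (s := {t | IsNodeCost n θ S B C R t}) ?_
  obtain ⟨m, x, hx⟩ := exists_singleton_cover n (node B C).graph S
  have hB : B.graph ⊆ (node B C).graph := graph_mono_of_sub (Sub.left (Sub.refl B))
  have hC : C.graph ⊆ (node B C).graph := graph_mono_of_sub (Sub.right (Sub.refl C))
  refine ⟨_, m, fun i => {x i}, fun i => {projMap n (coords_mono hB S) (x i)},
    fun i => {projMap n (coords_mono hC S) (x i)},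
    fun i => isPathset_of_subsingleton hn hθ Set.subsingleton_singleton,
    fun i => isPathset_of_subsingleton hn (fun e he => hθ e (hB he))
      Set.subsingleton_singleton,
    fun i => isPathset_of_subsingleton hn (fun e he => hθ e (hC he))
      Set.subsingleton_singleton, ?_, by rw [hx]; exact Set.subset_univ R, rfl⟩
  rintro i y rfl
  exact ⟨rfl, rfl⟩

lemma projMap_mem_restrictRel {n : ℕ} {F F' : Finset (Sym2 V)} (hF : F' ⊆ F) {S T : Set V}
    (hST : S ⊆ T) (z : V → Fin n) {R : Set (Tup n (coords F S))}
    {R' : Set (Tup n (coords F' S))} (h : ∀ x ∈ R, projMap n (coords_mono hF S) x ∈ R')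
    {x : Tup n (coords F T)} (hx : x ∈ restrictRel n F hST z R) :
    projMap n (coords_mono hF T) x ∈ restrictRel n F' hST z R' := by
  obtain ⟨y, hy, hyT, hyz⟩ := hx
  exact ⟨_, h y hy, fun v => hyT ⟨v.1, coords_mono hF T v.2⟩,
    fun v hv => hyz ⟨v.1, coords_mono hF S v.2⟩ hv⟩

lemma pchi_restrictRel_le {n : ℕ} (hn : 0 < n) {θ : Sym2 V → ℝ} {S T : Set V} (hST : S ⊆ T)
    (z : V → Fin n) (A : JoinTree V) (hθ : ∀ e ∈ A.graph, 0 ≤ θ e)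
    (R : Set (Tup n (coords A.graph S))) :
    pchi n θ T A (restrictRel n A.graph hST z R) ≤ pchi n θ S A R := by
  induction A with
  | leaf l =>
    obtain ⟨f, hf, hR⟩ := exists_leaf_cover hn S l hθ R
    rw [pchi]
    refine Nat.sInf_le ⟨fun i => restrictRel n _ hST z (f i),
      fun i => (hf i).restrictRel hST z, ?_⟩
    rw [← restrictRel_iUnion]
    exact restrictRel_mono n _ hST z hR
  | node B C ihB ihC =>
    obtain ⟨m, As, Bs, Cs, hA, hB, hC, hj, hR, ht⟩ := isNodeCost_pchi hn S B C hθ R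
    have hBA : B.graph ⊆ (node B C).graph := graph_mono_of_sub (Sub.left (Sub.refl B))
    have hCA : C.graph ⊆ (node B C).graph := graph_mono_of_sub (Sub.right (Sub.refl C))
    rw [ht]
    refine le_trans (b := ∑ i, max (pchi n θ T B (restrictRel n _ hST z (Bs i)))
      (pchi n θ T C (restrictRel n _ hST z (Cs i)))) ?_ ?_
    · rw [pchi_node]
      refine Nat.sInf_le ⟨m, fun i => restrictRel n _ hST z (As i),
        fun i => restrictRel n _ hST z (Bs i), fun i => restrictRel n _ hST z (Cs i),
        fun i => (hA i).restrictRel hST z, fun i => (hB i).restrictRel hST z,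
        fun i => (hC i).restrictRel hST z, fun i x hx =>
          ⟨projMap_mem_restrictRel hBA hST z (fun y hy => (hj i y hy).1) hx,
            projMap_mem_restrictRel hCA hST z (fun y hy => (hj i y hy).2) hx⟩, ?_, rfl⟩
      rw [← restrictRel_iUnion]
      exact restrictRel_mono n _ hST z hR
    · exact Finset.sum_le_sum fun i _ => max_le_max
        (ihB (fun e he => hθ e (hBA he)) _) (ihC (fun e he => hθ e (hCA he)) _)

/-- **Restriction Lemma.** For every relation `𝒜 ⊆ [n]^{A|S}`,
every `T ⊇ S` and every `z ∈ [n]^T`, `χ_{A|T}(𝒜 ↾ z) ≤ χ_{A|S}(𝒜)`. -/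
theorem stmt11 {V : Type*} (Eg : Set (Sym2 V)) (θ : Sym2 V → ℝ)
    (hθ : IsThresholdWeighting Eg θ) (n : ℕ) (hn : 0 < n)
    (A : JoinTree V) (hover : Over Eg A) (S : Set V)
    (R : Set (Tup n (coords A.graph S)))
    (T : Set V) (hST : S ⊆ T) (z : V → Fin n) :
    pchi n θ T A (restrictRel n A.graph hST z R) ≤ pchi n θ S A R := by
  exact pchi_restrictRel_le hn hST z A (fun e he => (hθ.1 e (hover he)).1) R

end Paper

end
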